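/- Every non-pathological Σ⁰₂ ideal on ω which is not countably generated is not Egorov. -/

import Mathlib

open MeasureTheory Set

/-- An ideal on a (countable) set `X`. -/
def IsIdeal {X : Type} (I : Set (Set X)) : Prop :=
  (∀ A B : Set X, A ∈ I → B ∈ I → A ∪ B ∈ I) ∧
  (∀ A B : Set X, A ⊆ B → B ∈ I → A ∈ I) ∧
  (∀ A : Set X, A.Finite → A ∈ I) ∧
  (Set.univ : Set X) ∉ I

/-- `I`-pointwise convergence on `[0,1]` of a family of functions. -/
def IConvPtwise {X : Type} (I : Set (Set X)) (f : X → ℝ → ℝ) (g : ℝ → ℝ) : Prop :=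
  ∀ t ∈ Icc (0:ℝ) 1, ∀ ε : ℝ, 0 < ε → {a : X | ε ≤ |f a t - g t|} ∈ I

/-- `I`-uniform convergence on `M` of a family of functions. -/
def IConvUnif {X : Type} (I : Set (Set X)) (f : X → ℝ → ℝ) (g : ℝ → ℝ) (M : Set ℝ) : Prop :=
  ∀ ε : ℝ, 0 < ε → {a : X | ∃ t ∈ M, ε ≤ |f a t - g t|} ∈ I

/-- `I` is an Egorov ideal. -/
def IsEgorov {X : Type} (I : Set (Set X)) : Prop :=
  ∀ (f : X → ℝ → ℝ) (g : ℝ → ℝ),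
    (∀ a : X, AEMeasurable (f a) (volume.restrict (Icc (0:ℝ) 1))) →
    AEMeasurable g (volume.restrict (Icc (0:ℝ) 1)) →
    IConvPtwise I f g →
    ∀ η : ℝ, 0 < η →
      ∃ M : Set ℝ, M ⊆ Icc (0:ℝ) 1 ∧ NullMeasurableSet M volume ∧
        volume (Icc (0:ℝ) 1 \ M) < ENNReal.ofReal η ∧
        IConvUnif I f g M

def IsSubmeasure (φ : Set ℕ → ENNReal) : Prop :=
  φ ∅ = 0 ∧ (∀ n : ℕ, φ {n} < ⊤) ∧
  ∀ A B : Set ℕ, φ A ≤ φ (A ∪ B) ∧ φ (A ∪ B) ≤ φ A + φ B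

def IsLscSubmeasure (φ : Set ℕ → ENNReal) : Prop :=
  ∀ A : Set ℕ, φ A = ⨆ n : ℕ, φ (A ∩ Iio n)

def IsNonpathological (φ : Set ℕ → ENNReal) : Prop :=
  ∀ A : Set ℕ, φ A = ⨆ (μ : Measure ℕ) (_ : ∀ B : Set ℕ, μ B ≤ φ B), μ A

/-- `I` is a non-pathological Σ⁰₂ ideal: `I = Fin(φ)` for some non-pathological
lsc submeasure `φ` with `φ(ω) = ∞`. -/
def IsNonpathSigma2 (I : Set (Set ℕ)) : Prop :=
  ∃ φ : Set ℕ → ENNReal, IsSubmeasure φ ∧ IsLscSubmeasure φ ∧ IsNonpathological φ ∧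
    φ Set.univ = ⊤ ∧ I = {A : Set ℕ | φ A < ⊤}

def IdealCountablyGenerated {X : Type} (I : Set (Set X)) : Prop :=
  ∃ B : Set (Set X), B.Countable ∧ B ⊆ I ∧
    ∀ A ∈ I, ∃ F : Set (Set X), F ⊆ B ∧ F.Finite ∧ A ⊆ ⋃₀ F

def IdealIso {X Y : Type} (I : Set (Set X)) (J : Set (Set Y)) : Prop :=
  ∃ f : Y → X, Function.Bijective f ∧ ∀ A : Set X, (A ∈ I ↔ f ⁻¹' A ∈ J)

def RKle {X Y : Type} (I : Set (Set X)) (J : Set (Set Y)) : Prop :=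
  ∃ f : Y → X, ∀ A : Set X, (A ∈ I ↔ f ⁻¹' A ∈ J)

def RBle {X Y : Type} (I : Set (Set X)) (J : Set (Set Y)) : Prop :=
  ∃ f : Y → X, (∀ x : X, (f ⁻¹' {x}).Finite) ∧ ∀ A : Set X, (A ∈ I ↔ f ⁻¹' A ∈ J)

/-- The restriction `I↾A` of an ideal, as an ideal on the subtype `↥A`. -/
def restrictIdeal {X : Type} (I : Set (Set X)) (A : Set X) : Set (Set ↥A) :=
  {S : Set ↥A | (Subtype.val '' S) ∈ I}

def IsTall {X : Type} (I : Set (Set X)) : Prop :=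
  ∀ A : Set X, A.Infinite → ∃ B ∈ I, B.Infinite ∧ B ⊆ A

/-- Intermediate values of Lebesgue measure inside a measurable subset of `[0,1]`. -/
theorem exists_sub_vol (A : Set ℝ) (hA : MeasurableSet A) (hA1 : A ⊆ Icc 0 1) (c : ENNReal)
    (hc : c ≤ volume A) : ∃ B ⊆ A, MeasurableSet B ∧ volume B = c := by
  have hfin : ∀ B : Set ℝ, B ⊆ A → volume B ≠ ⊤ := fun B hB =>
    ((measure_mono (hB.trans hA1)).trans_lt (by simp)).ne
  let F : ℝ → ℝ := fun x => (volume (A ∩ Iic x)).toReal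
  have hmono : ∀ x y, x ≤ y → F x ≤ F y ∧ F y ≤ F x + (y - x) := by
    intro x y hxy
    constructor
    · exact ENNReal.toReal_mono (hfin _ inter_subset_left)
        (measure_mono (inter_subset_inter_right _ (Iic_subset_Iic.2 hxy)))
    · have h1 : volume (A ∩ Iic y) ≤ volume (A ∩ Iic x) + ENNReal.ofReal (y - x) := by
        rw [← Real.volume_Ioc]
        refine (measure_mono ?_).trans (measure_union_le _ _)
        rintro t ⟨h, h'⟩
        by_cases htx : t ≤ x
        · exact Or.inl ⟨h, htx⟩
        · exact Or.inr ⟨not_le.1 htx, h'⟩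
      have h2 := ENNReal.toReal_mono
        (ENNReal.add_ne_top.2 ⟨hfin _ inter_subset_left, ENNReal.ofReal_ne_top⟩) h1
      rwa [ENNReal.toReal_add (hfin _ inter_subset_left) ENNReal.ofReal_ne_top,
        ENNReal.toReal_ofReal (by linarith)] at h2
  have hcont : Continuous F := by
    have : LipschitzWith 1 F := by
      apply LipschitzWith.of_le_add
      intro x y
      rw [Real.dist_eq]
      rcases le_total x y with h | h
      · have := (hmono x y h).1
        have := abs_nonneg (x - y)
        linarith
      · have := (hmono y x h).2
        have := le_abs_self (x - y)
        linarith
    exact this.continuous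
  have hctop : c ≠ ⊤ := ne_top_of_le_ne_top (hfin A subset_rfl) hc
  have h0 : F (-1) = 0 := by
    have : A ∩ Iic (-1) = ∅ := by
      ext t
      simp only [mem_inter_iff, mem_Iic, mem_empty_iff_false, iff_false, not_and]
      intro ht h
      have := (hA1 ht).1
      linarith
    simp [F, this]
  have h1 : F 1 = (volume A).toReal := by
    have : A ∩ Iic 1 = A := inter_eq_left.2 fun t ht => (hA1 ht).2
    simp [F, this]
  have hmem : c.toReal ∈ Icc (F (-1)) (F 1) := by
    rw [h0, h1]
    exact ⟨ENNReal.toReal_nonneg, ENNReal.toReal_mono (hfin A subset_rfl) hc⟩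
  obtain ⟨x, -, hx⟩ := intermediate_value_Icc (by norm_num : (-1:ℝ) ≤ 1) hcont.continuousOn hmem
  refine ⟨A ∩ Iic x, inter_subset_left, hA.inter measurableSet_Iic, ?_⟩
  exact (ENNReal.toReal_eq_toReal_iff' (hfin _ inter_subset_left) hctop).1 hx

/-- Splitting a measurable set according to prescribed weights. -/
theorem exists_split (w : ℕ → ENNReal) (P : Finset ℕ) (hP : P.Nonempty) :
    ∀ A : Set ℝ, MeasurableSet A → A ⊆ Icc 0 1 → ∑ j ∈ P, w j = volume A →
      ∃ n : ℝ → ℕ, Measurable n ∧ (∀ t, n t ∈ P) ∧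
        ∀ j ∈ P, volume (A ∩ n ⁻¹' {j}) ≤ w j := by
  classical
  induction hP using Finset.Nonempty.cons_induction with
  | singleton a =>
    intro A hA hA1 hw
    refine ⟨fun _ => a, measurable_const, by simp, ?_⟩
    intro j hj
    rw [Finset.mem_singleton.1 hj]
    rw [Finset.sum_singleton] at hw
    rw [hw]
    exact measure_mono inter_subset_left
  | cons a P ha hP ih =>
    intro A hA hA1 hw
    rw [Finset.sum_cons] at hw
    obtain ⟨B, hBA, hB, hBw⟩ := exists_sub_vol A hA hA1 (w a) (hw ▸ le_self_add)
    have hBt : volume B ≠ ⊤ := ((measure_mono (hBA.trans hA1)).trans_lt (by simp)).ne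
    have hd : ∑ j ∈ P, w j = volume (A \ B) := by
      rw [measure_diff hBA hB.nullMeasurableSet hBt, ← hw, hBw]
      exact (ENNReal.add_sub_cancel_left (hBw ▸ hBt)).symm
    obtain ⟨n, hn, hnP, hnw⟩ := ih (A \ B) (hA.diff hB) (diff_subset.trans hA1) hd
    refine ⟨fun t => if t ∈ B then a else n t, Measurable.ite hB measurable_const hn, ?_, ?_⟩
    · intro t
      by_cases h : t ∈ B <;> simp [h, hnP t]
    · intro j hj
      rcases Finset.mem_cons.1 hj with rfl | hj
      · rw [← hBw]
        apply measure_mono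
        rintro t ⟨h1, h2⟩
        by_contra h
        simp only [mem_preimage, h, if_false, mem_singleton_iff] at h2
        exact ha (h2 ▸ hnP t)
      · refine (measure_mono ?_).trans (hnw j hj)
        rintro t ⟨h1, h2⟩
        by_cases h : t ∈ B
        · simp only [mem_preimage, h, if_true, mem_singleton_iff] at h2
          exact absurd (h2 ▸ hj) ha
        · simp only [mem_preimage, h, if_false, mem_singleton_iff] at h2
          exact ⟨⟨h1, h⟩, h2⟩

/-- `s` is good (for the bound `m`): the family of sets of submeasure at most `m` containing `s`
is not covered by countably many members of the ideal. -/
def GoodNode (φ : Set ℕ → ENNReal) (m : ℕ) (s : Finset ℕ) : Prop :=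
  ¬ ∃ B : Set (Set ℕ), B.Countable ∧ (∀ b ∈ B, φ b < ⊤) ∧
    ∀ A : Set ℕ, φ A ≤ m → (s : Set ℕ) ⊆ A → ∃ b ∈ B, A ⊆ b

theorem submeasure_mono {φ : Set ℕ → ENNReal} (h : IsSubmeasure φ) {A B : Set ℕ} (hAB : A ⊆ B) :
    φ A ≤ φ B := by
  have := (h.2.2 A B).1
  rwa [union_eq_self_of_subset_left hAB] at this

theorem GoodNode.le {φ : Set ℕ → ENNReal} (h : IsSubmeasure φ) {m : ℕ} {s : Finset ℕ}
    (hs : GoodNode φ m s) : φ s ≤ m := by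
  by_contra hc
  refine hs ⟨∅, countable_empty, by simp, ?_⟩
  intro A hA hsA
  exact absurd ((submeasure_mono h hsA).trans hA) hc

theorem GoodNode.succ {φ : Set ℕ → ENNReal} {m : ℕ} {s : Finset ℕ}
    (hs : GoodNode φ m s) : φ {n | GoodNode φ m (insert n s)} = ⊤ := by
  by_contra hc
  apply hs
  have hex : ∀ n, ¬ GoodNode φ m (insert n s) → ∃ B : Set (Set ℕ), B.Countable ∧
      (∀ b ∈ B, φ b < ⊤) ∧
      ∀ A : Set ℕ, φ A ≤ m → ((insert n s : Finset ℕ) : Set ℕ) ⊆ A → ∃ b ∈ B, A ⊆ b :=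
    fun n hn => not_not.1 hn
  choose! B hB1 hB2 hB3 using hex
  refine ⟨insert {n | GoodNode φ m (insert n s)}
    (⋃ n ∈ {n | ¬ GoodNode φ m (insert n s)}, B n), ?_, ?_, ?_⟩
  · refine Countable.insert _ (Countable.biUnion (to_countable _) ?_)
    exact fun n hn => hB1 n hn
  · rintro b (rfl | hb)
    · exact lt_top_iff_ne_top.2 hc
    · simp only [mem_iUnion] at hb
      obtain ⟨n, hn, hb⟩ := hb
      exact hB2 n hn b hb
  · intro A hA hsA
    by_cases hall : ∀ n ∈ A, GoodNode φ m (insert n s)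
    · exact ⟨_, mem_insert _ _, hall⟩
    · push Not at hall
      obtain ⟨n, hnA, hn⟩ := hall
      obtain ⟨b, hb, hAb⟩ := hB3 n hn A hA (by
        rw [Finset.coe_insert]
        exact insert_subset hnA hsA)
      refine ⟨b, mem_insert_of_mem _ ?_, hAb⟩
      simp only [mem_iUnion]
      exact ⟨n, hn, hb⟩

theorem exists_goodNode {φ : Set ℕ → ENNReal}
    (hng : ¬ IdealCountablyGenerated {A : Set ℕ | φ A < ⊤}) : ∃ m, GoodNode φ m ∅ := by
  by_contra hc
  push Not at hc
  apply hng
  have hex : ∀ m : ℕ, ∃ B : Set (Set ℕ), B.Countable ∧ (∀ b ∈ B, φ b < ⊤) ∧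
      ∀ A : Set ℕ, φ A ≤ m → ((∅ : Finset ℕ) : Set ℕ) ⊆ A → ∃ b ∈ B, A ⊆ b :=
    fun m => not_not.1 (hc m)
  choose B hB1 hB2 hB3 using hex
  refine ⟨⋃ m, B m, countable_iUnion hB1, iUnion_subset hB2, ?_⟩
  intro A hA
  obtain ⟨m, hm⟩ := ENNReal.exists_nat_gt (ne_of_lt hA)
  obtain ⟨b, hb, hAb⟩ := hB3 m A hm.le (by simp)
  exact ⟨{b}, singleton_subset_iff.2 (mem_iUnion.2 ⟨m, hb⟩), finite_singleton b, by simpa using hAb⟩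

/-- One node splitting. -/
theorem node_split {φ : Set ℕ → ENNReal} (h : IsSubmeasure φ) (hl : IsLscSubmeasure φ)
    (hnp : IsNonpathological φ) {m : ℕ} (s : Finset ℕ) (hs : GoodNode φ m s) (k : ℕ)
    (S : Set ℝ) (hS : MeasurableSet S) (hS1 : S ⊆ Icc 0 1) :
    ∃ n : ℝ → ℕ, Measurable n ∧ (∀ t, GoodNode φ m (insert (n t) s)) ∧
      ∀ H : Set ℕ, volume S < 2 * volume (S ∩ n ⁻¹' H) → k ≤ 2 * φ H := by
  classical
  have hU := hs.succ
  rw [hl] at hU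
  obtain ⟨N, hN⟩ := lt_iSup_iff.1 (hU ▸ ENNReal.natCast_lt_top k)
  rw [hnp] at hN
  obtain ⟨μ, hN⟩ := lt_iSup_iff.1 hN
  obtain ⟨hμ, hN⟩ := lt_iSup_iff.1 hN
  let P : Finset ℕ := (Finset.range N).filter fun n => GoodNode φ m (insert n s)
  have hPe : {n | GoodNode φ m (insert n s)} ∩ Iio N = (P : Set ℕ) := by
    ext x; simp [P, and_comm]
  rw [hPe] at hN
  have hsum : ∀ Q : Finset ℕ, μ Q = ∑ j ∈ Q, μ {j} := fun Q => by
    rw [sum_measure_singleton]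
  have hsing : ∀ j, μ {j} ≠ ⊤ := fun j => ((hμ _).trans_lt (h.2.1 j)).ne
  have hPtop : μ P ≠ ⊤ := by
    rw [hsum]
    exact (ENNReal.sum_lt_top.2 fun j _ => lt_top_iff_ne_top.2 (hsing j)).ne
  have hP0 : μ P ≠ 0 := (lt_of_le_of_lt (zero_le) hN).ne'
  have hPn : P.Nonempty := by
    rw [Finset.nonempty_iff_ne_empty]
    intro he
    apply hP0
    simp [he]
  have hStop : volume S ≠ ⊤ := ((measure_mono hS1).trans_lt (by simp)).ne
  obtain ⟨n, hn, hnP, hnw⟩ := exists_split (fun j => μ {j} * (volume S / μ P)) P hPn S hS hS1 (by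
    rw [← Finset.sum_mul, ← hsum]
    exact ENNReal.mul_div_cancel hP0 hPtop)
  refine ⟨n, hn, fun t => (Finset.mem_filter.1 (hnP t)).2, ?_⟩
  intro H hH
  have h1 : volume (S ∩ n ⁻¹' H) ≤ φ H * (volume S / μ P) := by
    calc volume (S ∩ n ⁻¹' H)
        ≤ volume (⋃ j ∈ P.filter (· ∈ H), S ∩ n ⁻¹' {j}) := by
          apply measure_mono
          rintro t ⟨ht, htH⟩
          simp only [mem_iUnion]
          exact ⟨n t, Finset.mem_filter.2 ⟨hnP t, htH⟩, ht, rfl⟩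
      _ ≤ ∑ j ∈ P.filter (· ∈ H), volume (S ∩ n ⁻¹' {j}) := measure_biUnion_finset_le _ _
      _ ≤ ∑ j ∈ P.filter (· ∈ H), μ {j} * (volume S / μ P) :=
          Finset.sum_le_sum fun j hj => hnw j (Finset.mem_filter.1 hj).1
      _ = μ (P.filter (· ∈ H) : Finset ℕ) * (volume S / μ P) := by
          rw [← Finset.sum_mul, ← hsum]
      _ ≤ φ H * (volume S / μ P) := by
          gcongr
          refine (measure_mono ?_).trans (hμ H)
          intro j hj
          exact (Finset.mem_filter.1 hj).2
  by_contra hc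
  push Not at hc
  have h2 : volume S < volume S := by
    calc volume S < 2 * volume (S ∩ n ⁻¹' H) := hH
      _ ≤ 2 * (φ H * (volume S / μ P)) := by gcongr
      _ = (2 * φ H) * (volume S / μ P) := by ring
      _ ≤ μ P * (volume S / μ P) := by
          gcongr
          exact hc.le.trans hN.le
      _ = volume S := ENNReal.mul_div_cancel hP0 hPtop
  exact lt_irrefl _ h2

/-- The step of the construction. -/
theorem tree_step {φ : Set ℕ → ENNReal} (h : IsSubmeasure φ) (hl : IsLscSubmeasure φ)
    (hnp : IsNonpathological φ) {m : ℕ} (k : ℕ) (σ : ℝ → Finset ℕ)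
    (hσ : ∀ s, MeasurableSet {t | σ t = s}) (hg : ∀ t, GoodNode φ m (σ t)) :
    ∃ τ : ℝ → Finset ℕ, (∀ s, MeasurableSet {t | τ t = s}) ∧ (∀ t, GoodNode φ m (τ t)) ∧
      (∀ t, σ t ⊆ τ t) ∧
      ∀ M : Set ℝ, M ⊆ Icc 0 1 → NullMeasurableSet M volume → 1 < 2 * volume M →
        k ≤ 2 * φ {n | ∃ t ∈ M, n ∈ τ t} := by
  classical
  have hex : ∀ s : Finset ℕ, ∃ n : ℝ → ℕ, Measurable n ∧ (GoodNode φ m s →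
      (∀ t, GoodNode φ m (insert (n t) s)) ∧
      ∀ H : Set ℕ, volume ({t | σ t = s} ∩ Icc 0 1) <
        2 * volume ({t | σ t = s} ∩ Icc 0 1 ∩ n ⁻¹' H) → k ≤ 2 * φ H) := by
    intro s
    by_cases hs : GoodNode φ m s
    · obtain ⟨n, h1, h2⟩ := node_split h hl hnp s hs k ({t | σ t = s} ∩ Icc 0 1)
        ((hσ s).inter measurableSet_Icc) inter_subset_right
      exact ⟨n, h1, fun _ => h2⟩
    · exact ⟨fun _ => 0, measurable_const, fun h => absurd h hs⟩
  choose n hn hn2 using hex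
  refine ⟨fun t => insert (n (σ t) t) (σ t), ?_, fun t => (hn2 _ (hg t)).1 t,
    fun t => Finset.subset_insert _ _, ?_⟩
  · intro s
    have : {t | insert (n (σ t) t) (σ t) = s} =
        ⋃ r : Finset ℕ, ({t | σ t = r} ∩ (n r) ⁻¹' {j | insert j r = s}) := by
      ext t
      simp
    rw [this]
    exact MeasurableSet.iUnion fun r => (hσ r).inter (hn r (MeasurableSet.of_discrete))
  · intro M hM hMm hM1
    have hS : ∃ s, volume ({t | σ t = s} ∩ Icc 0 1) <
        2 * volume ({t | σ t = s} ∩ Icc 0 1 ∩ M) := by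
      by_contra hc
      push Not at hc
      have hcov : ∀ N : Set ℝ, N = ⋃ s, {t | σ t = s} ∩ N := by
        intro N; ext t; simp
      have hdis : Pairwise (Function.onFun Disjoint fun s => {t | σ t = s} ∩ Icc (0:ℝ) 1) := by
        intro a b hab
        refine Set.disjoint_left.2 ?_
        rintro t ⟨h1, -⟩ ⟨h2, -⟩
        exact hab (h1.symm.trans h2)
      have h1 : 2 * volume M ≤ 1 := by
        calc 2 * volume M
            ≤ 2 * ∑' s, volume ({t | σ t = s} ∩ Icc 0 1 ∩ M) := by
              gcongr
              refine (measure_mono ?_).trans (measure_iUnion_le _)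
              intro t ht
              exact mem_iUnion.2 ⟨σ t, ⟨rfl, hM ht⟩, ht⟩
          _ = ∑' s, 2 * volume ({t | σ t = s} ∩ Icc 0 1 ∩ M) := ENNReal.tsum_mul_left.symm
          _ ≤ ∑' s, volume ({t | σ t = s} ∩ Icc 0 1) := ENNReal.tsum_le_tsum hc
          _ = volume (⋃ s, {t | σ t = s} ∩ Icc (0:ℝ) 1) :=
              (measure_iUnion hdis fun s => (hσ s).inter measurableSet_Icc).symm
          _ = 1 := by rw [← hcov]; simp
      exact absurd hM1 (not_lt.2 h1)
    obtain ⟨s, hs⟩ := hS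
    have hsg : GoodNode φ m s := by
      by_contra hb
      have he : {t | σ t = s} = ∅ := by
        ext t
        simp only [mem_setOf_eq, mem_empty_iff_false, iff_false]
        rintro rfl
        exact hb (hg t)
      simp [he] at hs
    refine (hn2 s hsg).2 _ (hs.trans_le (mul_le_mul' le_rfl (measure_mono ?_)))
    rintro t ⟨⟨h1, h2⟩, h3⟩
    refine ⟨⟨h1, h2⟩, t, h3, ?_⟩
    change n s t ∈ insert (n (σ t) t) (σ t)
    rw [show σ t = s from h1]
    exact Finset.mem_insert_self _ _

/-- Every non-pathological Σ⁰₂ ideal on `ω` which is not countably generated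
is not Egorov. -/
theorem nonpath_sigma2_not_ctblyGen_not_egorov (I : Set (Set ℕ))
    (hI : IsNonpathSigma2 I) (hng : ¬ IdealCountablyGenerated I) : ¬ IsEgorov I := by
  classical
  obtain ⟨φ, h, hl, hnp, -, rfl⟩ := hI
  obtain ⟨m, hm⟩ := exists_goodNode hng
  intro hE
  let Q := {σ : ℝ → Finset ℕ // (∀ s, MeasurableSet {t | σ t = s}) ∧ ∀ t, GoodNode φ m (σ t)}
  have hex : ∀ (k : ℕ) (σ : Q), ∃ τ : Q, (∀ t, σ.1 t ⊆ τ.1 t) ∧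
      ∀ M : Set ℝ, M ⊆ Icc 0 1 → NullMeasurableSet M volume → 1 < 2 * volume M →
        k ≤ 2 * φ {n | ∃ t ∈ M, n ∈ τ.1 t} := by
    intro k σ
    obtain ⟨τ, h1, h2, h3⟩ := tree_step h hl hnp k σ.1 σ.2.1 σ.2.2
    exact ⟨⟨τ, h1, h2⟩, h3⟩
  choose step hstep1 hstep2 using hex
  let σ : ℕ → Q := fun k => Nat.rec ⟨fun _ => ∅, fun s => by simp, fun _ => hm⟩ step k
  have hσ : ∀ k, σ (k + 1) = step k (σ k) := fun k => rfl
  have hmono : ∀ t, Monotone fun k => (σ k).1 t := fun t =>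
    monotone_nat_of_le_succ fun k => hstep1 k (σ k) t
  let f : ℕ → ℝ → ℝ := fun n t => if ∃ k, n ∈ (σ k).1 t then 1 else 0
  have hfm : ∀ n, Measurable (f n) := by
    intro n
    refine Measurable.ite ?_ measurable_const measurable_const
    have : {t | ∃ k, n ∈ (σ k).1 t} = ⋃ k, ⋃ s ∈ {s : Finset ℕ | n ∈ s}, {t | (σ k).1 t = s} := by
      ext t
      simp
    rw [this]
    exact MeasurableSet.iUnion fun k => MeasurableSet.biUnion (to_countable _)
      fun s _ => (σ k).2.1 s
  have hconv : IConvPtwise {A : Set ℕ | φ A < ⊤} f (fun _ => 0) := by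
    intro t _ ε hε
    refine lt_of_le_of_lt ?_ (ENNReal.natCast_lt_top m)
    refine (submeasure_mono h (B := {n | ∃ k, n ∈ (σ k).1 t}) ?_).trans ?_
    · intro n hn
      by_contra hc
      simp only [mem_setOf_eq] at hn hc
      simp only [f, hc, if_false, sub_zero, abs_zero] at hn
      linarith
    · rw [hl]
      refine iSup_le fun N => ?_
      have hk : ∃ k, {n | ∃ k, n ∈ (σ k).1 t} ∩ Iio N ⊆ ((σ k).1 t : Set ℕ) := by
        induction N with
        | zero => exact ⟨0, by simp⟩
        | succ N ih =>
          obtain ⟨k, hk⟩ := ih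
          by_cases hN : ∃ k, N ∈ (σ k).1 t
          · obtain ⟨k', hk'⟩ := hN
            refine ⟨max k k', ?_⟩
            rintro n ⟨h1, h2⟩
            rcases Nat.lt_succ_iff_lt_or_eq.1 h2 with h2 | rfl
            · exact hmono t (le_max_left k k') (hk ⟨h1, h2⟩)
            · exact hmono t (le_max_right k k') hk'
          · refine ⟨k, ?_⟩
            rintro n ⟨h1, h2⟩
            rcases Nat.lt_succ_iff_lt_or_eq.1 h2 with h2 | rfl
            · exact hk ⟨h1, h2⟩
            · exact absurd h1 hN
      obtain ⟨k, hk⟩ := hk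
      exact (submeasure_mono h hk).trans (((σ k).2.2 t).le h)
  obtain ⟨M, hM, hMm, hMv, hu⟩ := hE f (fun _ => 0) (fun n => (hfm n).aemeasurable)
    aemeasurable_const hconv (1/2) (by norm_num)
  have hlt := hu 1 one_pos
  have hM1 : 1 < 2 * volume M := by
    have h1 : (1 : ENNReal) ≤ volume M + volume (Icc (0:ℝ) 1 \ M) := by
      calc (1 : ENNReal) = volume (Icc (0:ℝ) 1) := by simp
        _ ≤ volume (M ∪ (Icc (0:ℝ) 1 \ M)) := measure_mono (by simp)
        _ ≤ _ := measure_union_le _ _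
    have hMt : volume M ≠ ⊤ := ((measure_mono hM).trans_lt (by simp)).ne
    have hDt := hMv.ne_top
    rw [← ENNReal.ofReal_toReal hMt, ← ENNReal.ofReal_toReal hDt,
      ← ENNReal.ofReal_add ENNReal.toReal_nonneg ENNReal.toReal_nonneg,
      ENNReal.one_le_ofReal] at h1
    rw [← ENNReal.ofReal_toReal hDt] at hMv
    have h2 := (ENNReal.ofReal_lt_ofReal_iff (by norm_num)).1 hMv
    rw [← ENNReal.ofReal_toReal hMt, show (2 : ENNReal) = ENNReal.ofReal 2 by simp,
      ← ENNReal.ofReal_mul (by norm_num), ENNReal.one_lt_ofReal]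
    linarith
  have hbig : ∀ k : ℕ, (k : ENNReal) ≤ 2 * φ {a | ∃ t ∈ M, 1 ≤ |f a t - 0|} := by
    intro k
    refine (hstep2 k (σ k) M hM hMm hM1).trans ?_
    gcongr
    apply submeasure_mono h
    rintro n ⟨t, ht, hn⟩
    refine ⟨t, ht, ?_⟩
    have : ∃ k, n ∈ (σ k).1 t := ⟨k + 1, hn⟩
    simp [f, this]
  have hfin : 2 * φ {a | ∃ t ∈ M, 1 ≤ |f a t - 0|} ≠ ⊤ :=
    ENNReal.mul_ne_top (by simp) (ne_of_lt hlt)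
  obtain ⟨k, hk⟩ := ENNReal.exists_nat_gt hfin
  exact absurd (hbig k) (not_le.2 hk)
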